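/- For every τ₀ ∈ (0,1) there exists a constant C = C(τ₀) > 0 such that for all τ ∈ (0, τ₀) and all x ∈ ℝ, the second derivative of F_τ satisfies |F_τ''(x)| ≤ C(1 + |x|³). -/

import Mathlib

/-- The flow `Φ_t(x) = x / √(x² + (1 − x²)·exp(−2t))` of the ODE `x' = x − x³`. -/
noncomputable def Phi (t x : ℝ) : ℝ :=
  x / Real.sqrt (x ^ 2 + (1 - x ^ 2) * Real.exp (-2 * t))

/-- `F_τ(x) = (Φ_τ(x) − x)/τ`. -/
noncomputable def Ftau (τ x : ℝ) : ℝ := (Phi τ x - x) / τ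

lemma exp_le_Phi_radicand {t : ℝ} (ht : 0 < t) (x : ℝ) :
    Real.exp (-2 * t) ≤ x ^ 2 + (1 - x ^ 2) * Real.exp (-2 * t) := by
  have h : Real.exp (-2 * t) ≤ 1 := Real.exp_le_one_iff.2 (by linarith)
  nlinarith [mul_nonneg (sq_nonneg x) (sub_nonneg.2 h)]

lemma hasDerivAt_sqrt_Phi_radicand {t : ℝ} (ht : 0 < t) (x : ℝ) :
    HasDerivAt (fun y : ℝ => Real.sqrt (y ^ 2 + (1 - y ^ 2) * Real.exp (-2 * t)))
      ((1 - Real.exp (-2 * t)) * x / Real.sqrt (x ^ 2 + (1 - x ^ 2) * Real.exp (-2 * t))) x := by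
  have hpos := (Real.exp_pos (-2 * t)).trans_le (exp_le_Phi_radicand ht x)
  have hsq : HasDerivAt (fun y : ℝ => y ^ 2) (2 * x) x := by simpa using hasDerivAt_pow 2 x
  have hrad : HasDerivAt (fun y : ℝ => y ^ 2 + (1 - y ^ 2) * Real.exp (-2 * t))
      (2 * x + -(2 * x) * Real.exp (-2 * t)) x :=
    hsq.add ((hsq.const_sub 1).mul_const _)
  convert hrad.sqrt hpos.ne' using 1
  field_simp
  ring

lemma hasDerivAt_Phi {t : ℝ} (ht : 0 < t) (x : ℝ) :
    HasDerivAt (Phi t)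
      (Real.exp (-2 * t) / Real.sqrt (x ^ 2 + (1 - x ^ 2) * Real.exp (-2 * t)) ^ 3) x := by
  have hpos := (Real.exp_pos (-2 * t)).trans_le (exp_le_Phi_radicand ht x)
  have hs := Real.sqrt_pos.2 hpos
  have hsq := Real.sq_sqrt hpos.le
  refine ((hasDerivAt_id' x).div (hasDerivAt_sqrt_Phi_radicand ht x) hs.ne').congr_deriv ?_
  generalize Real.sqrt (x ^ 2 + (1 - x ^ 2) * Real.exp (-2 * t)) = s at hs hsq ⊢
  generalize Real.exp (-2 * t) = E at hsq ⊢
  field_simp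
  linear_combination hsq

lemma deriv_deriv_Ftau {τ : ℝ} (hτ : 0 < τ) (x : ℝ) :
    deriv (deriv (fun y => Ftau τ y)) x =
      -3 * (1 - Real.exp (-2 * τ)) * Real.exp (-2 * τ) * x /
        Real.sqrt (x ^ 2 + (1 - x ^ 2) * Real.exp (-2 * τ)) ^ 5 / τ := by
  have h₁ : deriv (fun y => Ftau τ y) = fun y =>
      (Real.exp (-2 * τ) / Real.sqrt (y ^ 2 + (1 - y ^ 2) * Real.exp (-2 * τ)) ^ 3 - 1) / τ :=
    funext fun y => (((hasDerivAt_Phi hτ y).sub (hasDerivAt_id y)).div_const τ).deriv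
  have hs := Real.sqrt_pos.2 ((Real.exp_pos (-2 * τ)).trans_le (exp_le_Phi_radicand hτ x))
  rw [h₁]
  refine HasDerivAt.deriv ?_
  refine ((((hasDerivAt_const x (Real.exp (-2 * τ))).div
    ((hasDerivAt_sqrt_Phi_radicand hτ x).pow 3) (pow_pos hs 3).ne').sub_const 1).div_const
    τ).congr_deriv ?_
  simp only [Pi.pow_apply]
  generalize Real.sqrt (x ^ 2 + (1 - x ^ 2) * Real.exp (-2 * τ)) = s at hs ⊢
  field_simp
  ring

/-- `|F_τ''(x)| ≤ C(1 + |x|³)` uniformly for `τ ∈ (0, τ₀)`. -/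
theorem Ftau_second_deriv_growth (τ₀ : ℝ) (hτ₀ : τ₀ ∈ Set.Ioo (0 : ℝ) 1) :
    ∃ C : ℝ, 0 < C ∧ ∀ τ ∈ Set.Ioo (0 : ℝ) τ₀, ∀ x : ℝ,
      |deriv (deriv (fun y => Ftau τ y)) x| ≤ C * (1 + |x| ^ 3) := by
  refine ⟨6 / Real.exp (-1) ^ 5, by positivity, fun τ ⟨hτ, hττ₀⟩ x => ?_⟩
  have hE : Real.exp (-2 * τ) ≤ 1 := Real.exp_le_one_iff.2 (by linarith)
  have ha : 1 - Real.exp (-2 * τ) ≤ 2 * τ := by linarith [Real.add_one_le_exp (-2 * τ)]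
  have hs : Real.exp (-1) ≤ Real.sqrt (x ^ 2 + (1 - x ^ 2) * Real.exp (-2 * τ)) := by
    refine Real.le_sqrt_of_sq_le (le_trans ?_ (exp_le_Phi_radicand hτ x))
    rw [← Real.exp_nat_mul]
    exact Real.exp_le_exp.2 (by push_cast; linarith [hτ₀.2])
  have hx : |x| ≤ 1 + |x| ^ 3 := by
    nlinarith [abs_nonneg x, mul_nonneg (abs_nonneg x) (sq_nonneg (|x| - 1)), sq_nonneg (|x| - 1)]
  have hs₀ := (Real.exp_pos (-1)).trans_le hs
  have hE₀ := Real.exp_pos (-2 * τ)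
  have hnum : 3 * (1 - Real.exp (-2 * τ)) * Real.exp (-2 * τ) * |x| ≤ 6 * |x| * τ := by
    have h : (1 - Real.exp (-2 * τ)) * Real.exp (-2 * τ) ≤ 2 * τ := by nlinarith
    nlinarith [mul_le_mul_of_nonneg_right h (abs_nonneg x)]
  rw [deriv_deriv_Ftau hτ, abs_div, abs_div, abs_mul, abs_mul, abs_mul, abs_of_pos hτ,
    abs_of_pos (pow_pos hs₀ 5), abs_of_pos hE₀, abs_of_nonneg (sub_nonneg.2 hE), abs_neg,
    abs_of_pos (three_pos : (0 : ℝ) < 3), div_right_comm]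
  calc _ ≤ 6 * |x| / Real.sqrt (x ^ 2 + (1 - x ^ 2) * Real.exp (-2 * τ)) ^ 5 := by
        gcongr
        exact (div_le_iff₀ hτ).2 hnum
    _ ≤ 6 * (1 + |x| ^ 3) / Real.exp (-1) ^ 5 := by gcongr
    _ = _ := by ring
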